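/- There is a family {F_n} of unsatisfiable 3-CNF formulas with Θ(n) clauses and variables such that, over any field F, for every constant δ with 0 < δ < 1 there exist constants c_1, c_2 > 0 such that for all sufficiently large n and every d with n^δ ≤ d ≤ n: (1) F_n has a Nullstellensatz refutation of degree at most c_1·d and size at most c_1·n²/d; and (2) every Nullstellensatz refutation of F_n of degree at most d has size at least c_2·n²/d. -/

import Mathlib

open MvPolynomial

/-- A Nullstellensatz certificate (refutation): `∑ i, r i * p i + ∑ j, s j * (X j ^ 2 - X j) = 1`. -/
def IsNSCert {F σ ι : Type} [Field F] [Fintype σ] [Fintype ι]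
    (p r : ι → MvPolynomial σ F) (s : σ → MvPolynomial σ F) : Prop :=
  ∑ i, r i * p i + ∑ j, s j * (X j ^ 2 - X j) = 1

/-- The size of a Nullstellensatz refutation:
`∑ i, m(r i) * m(p i) + ∑ j, 2 * m(s j)` where `m` counts monomials. -/
noncomputable def nsSize {F σ ι : Type} [Field F] [Fintype σ] [Fintype ι]
    (p r : ι → MvPolynomial σ F) (s : σ → MvPolynomial σ F) : ℕ :=
  ∑ i, (r i).support.card * (p i).support.card + ∑ j, 2 * (s j).support.card

/-- The degree of a Nullstellensatz refutation: the maximum of the degrees of the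
polynomials `r i * p i` and `s j * (X j ^ 2 - X j)`. -/
noncomputable def nsDegree {F σ ι : Type} [Field F] [Fintype σ] [Fintype ι]
    (p r : ι → MvPolynomial σ F) (s : σ → MvPolynomial σ F) : ℕ :=
  max (Finset.univ.sup fun i => (r i * p i).totalDegree)
    (Finset.univ.sup fun j => (s j * (X j ^ 2 - X j)).totalDegree)

/-- A clause over `n` Boolean variables, given by its sets of positive and negative literals. -/
abbrev Clause (n : ℕ) := Finset (Fin n) × Finset (Fin n)

/-- A CNF formula: a number of variables together with a set of clauses. -/
structure CNF where
  nvars : ℕ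
  clauses : Finset (Clause nvars)

/-- A 3-CNF formula: every clause has at most 3 literals. -/
def CNF.Is3CNF (φ : CNF) : Prop := ∀ C ∈ φ.clauses, C.1.card + C.2.card ≤ 3

/-- Satisfaction of a clause by a Boolean assignment. -/
def Clause.Sat {n : ℕ} (a : Fin n → Bool) (C : Clause n) : Prop :=
  (∃ x ∈ C.1, a x = true) ∨ (∃ y ∈ C.2, a y = false)

/-- Unsatisfiability of a CNF formula. -/
def CNF.Unsat (φ : CNF) : Prop :=
  ∀ a : Fin φ.nvars → Bool, ∃ C ∈ φ.clauses, ¬ Clause.Sat a C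

/-- The polynomial translation `∏_{x ∈ P}(1 - x) * ∏_{y ∈ N} y` of a clause. -/
noncomputable def Clause.poly (F : Type) [Field F] {n : ℕ} (C : Clause n) :
    MvPolynomial (Fin n) F :=
  (∏ x ∈ C.1, (1 - X x)) * ∏ y ∈ C.2, X y

/-- The family of polynomial translations of the clauses of a CNF formula. -/
noncomputable def CNF.polys (F : Type) [Field F] (φ : CNF) :
    {C // C ∈ φ.clauses} → MvPolynomial (Fin φ.nvars) F :=
  fun C => Clause.poly F C.1


/-- Bit reversal of the `m` low bits. -/
def bitrev : ℕ → ℕ → ℕ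
  | 0, _ => 0
  | (m+1), i => (i % 2) * 2 ^ m + bitrev m (i / 2)

theorem bitrev_lt (m i : ℕ) : bitrev m i < 2 ^ m := by
  induction m generalizing i with
  | zero => simp [bitrev]
  | succ m ih =>
    have h := ih (i / 2)
    have h2 : i % 2 ≤ 1 := by omega
    have h3 : (i % 2) * 2 ^ m ≤ 1 * 2 ^ m := Nat.mul_le_mul_right _ h2
    simp only [bitrev, pow_succ]
    omega

theorem bitrev_split (j l a b : ℕ) (hb : b < 2 ^ j) :
    bitrev (j + l) (a * 2 ^ j + b) = bitrev j b * 2 ^ l + bitrev l a := by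
  induction j generalizing b with
  | zero =>
    have : b = 0 := by simpa using hb
    subst this
    simp [bitrev]
  | succ j ih =>
    have e : j + 1 + l = (j + l) + 1 := by omega
    rw [e]
    simp only [bitrev]
    have h1 : (a * 2 ^ (j + 1) + b) % 2 = b % 2 := by
      rw [pow_succ, ← mul_assoc]; omega
    have h2 : (a * 2 ^ (j + 1) + b) / 2 = a * 2 ^ j + b / 2 := by
      rw [pow_succ, ← mul_assoc]; omega
    have h3 : b / 2 < 2 ^ j := by rw [pow_succ] at hb; omega
    rw [h1, h2, ih _ h3]
    ring

theorem bitrev_surj (j q : ℕ) (hq : q < 2 ^ j) : ∃ b < 2 ^ j, bitrev j b = q := by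
  induction j generalizing q with
  | zero => exact ⟨0, by simp, by simp at hq; simp [bitrev, hq]⟩
  | succ j ih =>
    have h2 : q % 2 ^ j < 2 ^ j := Nat.mod_lt _ (by positivity)
    obtain ⟨b, hb, hb'⟩ := ih (q % 2 ^ j) h2
    have h3 : q / 2 ^ j < 2 := by
      rw [Nat.div_lt_iff_lt_mul (by positivity)]; rw [pow_succ] at hq; omega
    refine ⟨2 * b + q / 2 ^ j, by rw [pow_succ]; omega, ?_⟩
    simp only [bitrev]
    have e1 : (2 * b + q / 2 ^ j) % 2 = q / 2 ^ j := by
      generalize q / 2 ^ j = w at *; omega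
    have e2 : (2 * b + q / 2 ^ j) / 2 = b := by
      generalize q / 2 ^ j = w at *; omega
    rw [e1, e2, hb']
    exact Nat.div_add_mod' q (2 ^ j)

/-- A (black, hence also reversible) pebbling run `c 0, …, c T` on vertices `ℕ`. -/
structure PebRun (pr : ℕ → ℕ → Prop) (c : ℕ → Finset ℕ) (T d : ℕ) : Prop where
  start : c 0 = ∅
  card : ∀ t ≤ T, (c t).card ≤ d
  pred : ∀ t < T, ∀ v, v ∉ c t → v ∈ c (t + 1) → ∀ u, pr u v → u ∈ c t
  uniq : ∀ t < T, ∀ v w, v ∉ c t → v ∈ c (t + 1) → w ∉ c t → w ∈ c (t + 1) → v = w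

theorem PebRun.step {c : ℕ → Finset ℕ} {v t0 t1 : ℕ} (h01 : t0 ≤ t1) (h0 : v ∉ c t0)
    (h1 : v ∈ c t1) : ∃ t, t0 ≤ t ∧ t < t1 ∧ v ∉ c t ∧ v ∈ c (t + 1) := by
  induction t1, h01 using Nat.le_induction with
  | base => exact absurd h1 h0
  | succ n hn ih =>
    by_cases h : v ∈ c n
    · obtain ⟨t, a, b, e⟩ := ih h
      exact ⟨t, a, by omega, e⟩
    · exact ⟨n, hn, by omega, h, h1⟩

theorem PebRun.down {pr : ℕ → ℕ → Prop} {c : ℕ → Finset ℕ} {T d : ℕ} (h : PebRun pr c T d)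
    (hpr : ∀ u, pr u (u + 1)) {t0 t1 : ℕ} (h1T : t1 ≤ T) (s u : ℕ) :
    ∀ t', t0 ≤ t' → t' < t1 → u + s ∈ c t' → (∀ x, u ≤ x → x ≤ u + s → x ∉ c t0) →
    ∃ t, t0 ≤ t ∧ t < t1 ∧ u ∈ c t := by
  induction s with
  | zero => intro t' a b e _; exact ⟨t', a, b, e⟩
  | succ s ih =>
    intro t' a b e hx
    obtain ⟨t, ha, hb, hc, hd⟩ := PebRun.step a (hx (u + (s + 1)) (by omega) (by omega)) e
    exact ih t ha (by omega) (h.pred t (by omega) _ hc hd _ (hpr (u + s)))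
      (fun x h1 h2 => hx x h1 (by omega))

theorem PebRun.count {pr : ℕ → ℕ → Prop} {c : ℕ → Finset ℕ} {T d : ℕ} (h : PebRun pr c T d)
    {t0 t1 : ℕ} (h1T : t1 ≤ T) (W : Finset ℕ)
    (hW : ∀ u ∈ W, u ∉ c t0 ∧ ∃ t, t0 ≤ t ∧ t < t1 ∧ u ∈ c t) : W.card ≤ t1 - t0 := by
  have : ∀ u ∈ W, ∃ t, t0 ≤ t ∧ t < t1 ∧ u ∉ c t ∧ u ∈ c (t + 1) := by
    intro u hu
    obtain ⟨h0, t, a, b, e⟩ := hW u hu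
    obtain ⟨t', ha, hb, hc⟩ := PebRun.step a h0 e
    exact ⟨t', ha, by omega, hc⟩
  choose! g hg using this
  rw [← Nat.card_Ico t0 t1]
  refine Finset.card_le_card_of_injOn g ?_ ?_
  · intro u hu
    have := hg u hu
    simp; omega
  · intro u hu v hv huv
    have a := hg u hu
    have b := hg v hv
    rw [← huv] at b
    exact h.uniq (g u) (by omega) u v a.2.2.1 a.2.2.2 b.2.2.1 b.2.2.2

/-- first pebbling times -/
theorem PebRun.first {pr : ℕ → ℕ → Prop} {c : ℕ → Finset ℕ} {T d : ℕ} (h : PebRun pr c T d)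
    (hpr : ∀ u, pr u (u + 1)) (z : ℕ) (hz : z ∈ c T) :
    ∃ τ : ℕ → ℕ, τ z ≤ T ∧ (∀ v < z, τ v < τ (v + 1)) ∧ (∀ v ≤ z, 1 ≤ τ v) ∧
      (∀ v ≤ z, ∀ t < τ v, v ∉ c t) ∧ (∀ v ≤ z, v ∈ c (τ v)) := by
  have ex : ∀ s v, v + s = z → ∃ t ≤ T, v ∈ c t := by
    intro s
    induction s with
    | zero => intro v hv; exact ⟨T, le_rfl, by rwa [← hv] at hz⟩
    | succ s ih =>
      intro v hv
      obtain ⟨t, ht, hm⟩ := ih (v + 1) (by omega)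
      obtain ⟨t', ha, hb, hc, hd⟩ := PebRun.step (Nat.zero_le t) (by simp [h.start]) hm
      exact ⟨t', by omega, h.pred t' (by omega) _ hc hd _ (hpr v)⟩
  have ex' : ∀ v, v ≤ z → ∃ t, t ≤ T ∧ v ∈ c t := fun v hv => ex (z - v) v (by omega)
  classical
  have key : ∀ v, ∃ τ, v ≤ z → (τ ≤ T ∧ v ∈ c τ ∧ ∀ t < τ, v ∉ c t) := by
    intro v
    by_cases hv : v ≤ z
    · refine ⟨Nat.find (ex' v hv), fun _ => ?_⟩
      have a := Nat.find_spec (ex' v hv)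
      refine ⟨a.1, a.2, fun t ht hm => Nat.find_min (ex' v hv) ht ⟨by omega, hm⟩⟩
    · exact ⟨0, fun h => absurd h hv⟩
  choose τ hτ using key
  refine ⟨τ, (hτ z le_rfl).1, ?_, ?_, fun v hv => (hτ v hv).2.2, fun v hv => (hτ v hv).2.1⟩
  · intro v hv
    obtain ⟨a, b, e⟩ := hτ (v + 1) (by omega)
    obtain ⟨t', ha, hb, hc, hd⟩ := PebRun.step (Nat.zero_le _) (by simp [h.start]) b
    have := h.pred t' (by omega) _ hc hd _ (hpr v)
    by_contra hcon
    exact (hτ v (by omega)).2.2 t' (by omega) this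
  · intro v hv
    by_contra hcon
    have h0 : τ v = 0 := by omega
    have := (hτ v hv).2.1
    rw [h0, h.start] at this
    simp at this

theorem PebRun.trivial_lower {pr : ℕ → ℕ → Prop} {c : ℕ → Finset ℕ} {T d : ℕ}
    (h : PebRun pr c T d) (hpr : ∀ u, pr u (u + 1)) (z : ℕ) (hz : z ∈ c T) : z < T := by
  obtain ⟨τ, h1, h2, h3, -, -⟩ := h.first hpr z hz
  have : ∀ v ≤ z, v < τ v := by
    intro v
    induction v with
    | zero => intro _; exact h3 0 (by omega)
    | succ v ih => intro hv; have := ih (by omega); have := h2 v (by omega); omega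
  have := this z le_rfl
  omega

theorem PebRun.lower {pr : ℕ → ℕ → Prop} {c : ℕ → Finset ℕ} {T d j l : ℕ}
    (h : PebRun pr c T d) (hpr : ∀ u, pr u (u + 1))
    (hrev : ∀ i, pr (bitrev (j + l) i) (2 ^ (j + l) + i))
    (hz : 2 * 2 ^ (j + l) - 1 ∈ c T) :
    2 ^ l * ((2 ^ j - 1 - d) * 2 ^ l) ≤ T := by
  obtain ⟨τ, h1, h2, h3, h4, h5⟩ := h.first hpr _ hz
  set N := 2 ^ (j + l) with hN
  have hNpos : 1 ≤ N := Nat.one_le_two_pow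
  have hmono : ∀ b, b ≤ 2 * N - 1 → ∀ a, a ≤ b → τ a ≤ τ b := by
    intro b
    induction b with
    | zero => intro _ a ha; simp at ha; simp [ha]
    | succ b ih =>
      intro hb a ha
      rcases Nat.lt_or_ge b a with h' | h'
      · have : a = b + 1 := by omega
        rw [this]
      · exact (ih (by omega) a h').trans (h2 b (by omega)).le
  have hNe : 2 ^ l * 2 ^ j = N := by rw [hN, pow_add, mul_comm]
  have main : ∀ k ≤ 2 ^ l, k * ((2 ^ j - 1 - d) * 2 ^ l) ≤ τ (N - 1 + k * 2 ^ j) := by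
    intro k
    induction k with
    | zero => simp
    | succ k ih =>
      intro hk
      have ih := ih (by omega)
      have hk2 : (k + 1) * 2 ^ j ≤ N := by rw [← hNe]; exact Nat.mul_le_mul_right _ hk
      have hk3 : (k + 1) * 2 ^ j = k * 2 ^ j + 2 ^ j := by ring
      have hjpos : 0 < 2 ^ j := by positivity
      set t0 := τ (N - 1 + k * 2 ^ j) with ht0
      set t1 := τ (N - 1 + (k + 1) * 2 ^ j) with ht1
      have ht1T : t1 ≤ T := (hmono _ le_rfl _ (by omega)).trans h1
      have h01 : t0 ≤ t1 := hmono _ (by omega) _ (by omega)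
      set off := bitrev l k with hoff
      -- queried points
      have query : ∀ q < 2 ^ j, ∃ t, t0 ≤ t ∧ t < t1 ∧ q * 2 ^ l + off ∈ c t := by
        intro q hq
        obtain ⟨b, hb, hbq⟩ := bitrev_surj j q hq
        have e : bitrev (j + l) (k * 2 ^ j + b) = q * 2 ^ l + off := by
          rw [bitrev_split j l k b hb, hbq]
        have hv : N + (k * 2 ^ j + b) ≤ 2 * N - 1 := by omega
        have hlt : t0 < τ (N + (k * 2 ^ j + b)) := by
          have a1 := h2 (N - 1 + k * 2 ^ j) (by omega)
          have a2 := hmono _ hv (N - 1 + k * 2 ^ j + 1) (by omega)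
          omega
        have hle : τ (N + (k * 2 ^ j + b)) ≤ t1 := hmono _ (by omega) _ (by omega)
        refine ⟨τ (N + (k * 2 ^ j + b)) - 1, by omega, by omega, ?_⟩
        rw [← e]
        have e2 : τ (N + (k * 2 ^ j + b)) - 1 + 1 = τ (N + (k * 2 ^ j + b)) := by omega
        refine h.pred _ (by omega) (N + (k * 2 ^ j + b)) (h4 _ hv _ (by omega)) ?_ _ (hrev _)
        rw [e2]; exact h5 _ hv
      set bad : Finset ℕ := (c t0).image (fun u => (u - (off + 1)) / 2 ^ l) with hbad
      have hbadc : bad.card ≤ d := Finset.card_image_le.trans (h.card t0 (by omega))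
      set good : Finset ℕ := (Finset.range (2 ^ j - 1)) \ bad with hgood
      have hgoodc : 2 ^ j - 1 - d ≤ good.card := by
        have := Finset.le_card_sdiff bad (Finset.range (2 ^ j - 1))
        rw [Finset.card_range, ← hgood] at this
        omega
      set W : Finset ℕ := (good ×ˢ Finset.range (2 ^ l)).image
        (fun x => off + 1 + (x.1 * 2 ^ l + x.2)) with hWdef
      have hlpos : 0 < 2 ^ l := by positivity
      have hWc : W.card = good.card * 2 ^ l := by
        rw [hWdef, Finset.card_image_of_injOn, Finset.card_product, Finset.card_range]
        rintro ⟨a, b⟩ hab ⟨a', b'⟩ hab' hh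
        simp at hab hab' hh
        have e1 : (a * 2 ^ l + b) / 2 ^ l = a := by
          rw [mul_comm, Nat.mul_add_div hlpos, Nat.div_eq_of_lt hab.2]; rfl
        have e2 : (a' * 2 ^ l + b') / 2 ^ l = a' := by
          rw [mul_comm, Nat.mul_add_div hlpos, Nat.div_eq_of_lt hab'.2]; rfl
        rw [hh, e2] at e1
        subst e1
        simp at hh
        simp [hh]
      have hfree : ∀ a ∈ good, ∀ b < 2 ^ l, off + 1 + (a * 2 ^ l + b) ∉ c t0 := by
        intro a ha b hb hm
        have e1 : (a * 2 ^ l + b) / 2 ^ l = a := by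
          rw [mul_comm, Nat.mul_add_div hlpos, Nat.div_eq_of_lt hb]; rfl
        have : a ∈ bad := by
          rw [hbad, Finset.mem_image]
          exact ⟨_, hm, by rw [Nat.add_sub_cancel_left, e1]⟩
        exact (Finset.mem_sdiff.mp ha).2 this
      have hcount := h.count ht1T W (t0 := t0) (by
        intro u hu
        rw [hWdef, Finset.mem_image] at hu
        obtain ⟨⟨a, b⟩, hab, rfl⟩ := hu
        rw [Finset.mem_product, Finset.mem_range] at hab
        obtain ⟨ha, hb⟩ := hab
        simp only at ha hb ⊢
        refine ⟨hfree a ha b hb, ?_⟩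
        have ha' : a + 1 < 2 ^ j := by
          have := (Finset.mem_sdiff.mp ha).1
          rw [Finset.mem_range] at this; omega
        obtain ⟨t, hta, htb, htc⟩ := query (a + 1) ha'
        have e3 : (a + 1) * 2 ^ l + off = off + 1 + (a * 2 ^ l + b) + (2 ^ l - 1 - b) := by
          have : (a + 1) * 2 ^ l = a * 2 ^ l + 2 ^ l := by ring
          omega
        rw [e3] at htc
        refine h.down hpr ht1T _ _ t hta htb htc ?_
        intro x hx1 hx2
        have := hfree a ha (x - (off + 1 + a * 2 ^ l)) (by omega)
        have e4 : off + 1 + (a * 2 ^ l + (x - (off + 1 + a * 2 ^ l))) = x := by omega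
        rwa [e4] at this)
      have : (2 ^ j - 1 - d) * 2 ^ l ≤ W.card := by
        rw [hWc]; exact Nat.mul_le_mul_right _ hgoodc
      rw [Nat.succ_mul]
      omega
  have := main (2 ^ l) le_rfl
  rw [hNe] at this
  have e : N - 1 + N = 2 * N - 1 := by omega
  rw [e] at this
  omega

/-- `Peb pr s t A B`: reversible pebbling from `A` to `B` in at most `t` moves, all configurations
having at most `s` pebbles. -/
inductive Peb {V : Type} [DecidableEq V] (pr : V → Finset V) (s : ℕ) :
    ℕ → Finset V → Finset V → Prop
  | refl (t : ℕ) (A : Finset V) (hA : A.card ≤ s) : Peb pr s t A A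
  | add (t : ℕ) (A B : Finset V) (v : V) (h : Peb pr s t A B) (hp : pr v ⊆ B)
      (hc : (insert v B).card ≤ s) : Peb pr s (t + 1) A (insert v B)
  | rem (t : ℕ) (A B : Finset V) (v : V) (h : Peb pr s t A (insert v B)) (hp : pr v ⊆ B)
      (hc : (insert v B).card ≤ s) : Peb pr s (t + 1) A B

section PebLemmas
namespace Peb

variable {V : Type} [DecidableEq V] {pr : V → Finset V}

theorem weaken {s t s' t' : ℕ} {A B : Finset V} (h : Peb pr s t A B) (hs : s ≤ s')
    (ht : t ≤ t') : Peb pr s' t' A B := by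
  induction h generalizing t' with
  | refl t A hA => exact refl _ _ (hA.trans hs)
  | add t A B v h hp hc ih =>
    obtain ⟨k, rfl⟩ : ∃ k, t' = k + 1 := ⟨t' - 1, by omega⟩
    exact add k A B v (ih (by omega)) hp (hc.trans hs)
  | rem t A B v h hp hc ih =>
    obtain ⟨k, rfl⟩ : ∃ k, t' = k + 1 := ⟨t' - 1, by omega⟩
    exact rem k A B v (ih (by omega)) hp (hc.trans hs)

theorem trans {s t t' : ℕ} {A B C : Finset V} (h : Peb pr s t A B) (h' : Peb pr s t' B C) :
    Peb pr s (t + t') A C := by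
  induction h' with
  | refl t' B hB => exact h.weaken le_rfl (by omega)
  | add t' B C v h' hp hc ih => exact add _ _ _ _ (ih h) hp hc
  | rem t' B C v h' hp hc ih => exact rem _ _ _ _ (ih h) hp hc

theorem symm {s t : ℕ} {A B : Finset V} (h : Peb pr s t A B) : Peb pr s t B A := by
  induction h with
  | refl t A hA => exact refl _ _ hA
  | add t A B v h hp hc ih =>
    have : Peb pr s 1 (insert v B) B := rem 0 _ _ v (refl _ _ hc) hp hc
    exact (this.trans ih).weaken le_rfl (by omega)
  | rem t A B v h hp hc ih =>
    have : Peb pr s 1 B (insert v B) :=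
      add 0 _ _ v (refl _ _ ((Finset.card_le_card (Finset.subset_insert _ _)).trans hc)) hp hc
    exact (this.trans ih).weaken le_rfl (by omega)

theorem frame {s t : ℕ} {A B : Finset V} (h : Peb pr s t A B) (D : Finset V) :
    Peb pr (s + D.card) t (A ∪ D) (B ∪ D) := by
  have key : ∀ A : Finset V, A.card ≤ s → (A ∪ D).card ≤ s + D.card := fun A hA =>
    (Finset.card_union_le _ _).trans (by omega)
  induction h with
  | refl t A hA => exact refl _ _ (key _ hA)
  | add t A B v h hp hc ih =>
    rw [Finset.insert_union]
    refine add _ _ _ _ ih (hp.trans Finset.subset_union_left) ?_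
    rw [← Finset.insert_union]; exact key _ hc
  | rem t A B v h hp hc ih =>
    rw [Finset.insert_union] at ih
    refine rem _ _ _ v ih (hp.trans Finset.subset_union_left) ?_
    rw [← Finset.insert_union]; exact key _ hc

theorem frame' {s t s' : ℕ} {A B A' B' : Finset V} (h : Peb pr s t A B) (D : Finset V)
    (hA : A ∪ D = A') (hB : B ∪ D = B') (hs : s + D.card ≤ s') :
    Peb pr s' t A' B' := by
  subst hA hB
  exact (h.frame D).weaken hs le_rfl

/-- Macro pebbling of a path `f a, f (a+1), …`. -/
theorem path (f : ℕ → V) (K : Finset V) (s0 t0 lo hi : ℕ)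
    (hstep : ∀ i, lo ≤ i → i < hi → Peb pr s0 t0 (insert (f i) K) (insert (f (i+1)) (insert (f i) K)))
    (hK : K.card + 1 ≤ s0)
    (b k : ℕ) : ∀ a l, lo ≤ a → a + l ≤ hi → l ≤ b ^ k →
    Peb pr (s0 + k * b) ((2 * b) ^ k * t0) (insert (f a) K) (insert (f (a + l)) (insert (f a) K)) := by
  induction k with
  | zero =>
    intro a l ha hl hlb
    have hl2 : l = 0 ∨ l = 1 := by simp at hlb; omega
    rcases hl2 with rfl | rfl
    · simp only [add_zero, Finset.insert_idem]
      exact refl _ _ ((Finset.card_insert_le _ _).trans (by omega))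
    · exact (hstep a ha (by omega)).weaken (by omega) (by simp)
  | succ k ih =>
    have inner : ∀ j a l, lo ≤ a → a + l ≤ hi → l ≤ j * b ^ k →
        Peb pr (s0 + k * b + j) (2 * j * ((2 * b) ^ k * t0)) (insert (f a) K)
          (insert (f (a + l)) (insert (f a) K)) := by
      intro j
      induction j with
      | zero =>
        intro a l ha hl hlb
        have : l = 0 := by simpa using hlb
        subst this
        simp only [add_zero, Finset.insert_idem]
        exact refl _ _ ((Finset.card_insert_le _ _).trans (by omega))
      | succ j ihj =>
        intro a l ha hl hlb
        set q := min l (b ^ k) with hq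
        have hql : q ≤ l := min_le_left _ _
        have hqb : q ≤ b ^ k := min_le_right _ _
        have hrest : l - q ≤ j * b ^ k := by
          rw [Nat.succ_mul] at hlb
          omega
        have p1 := ih a q ha (by omega) hqb
        have p2 := ihj (a + q) (l - q) (by omega) (by omega) hrest
        have e : a + q + (l - q) = a + l := by omega
        rw [e] at p2
        have p2' := p2.frame' (s' := s0 + k * b + (j + 1)) {f a}
          (A' := insert (f (a + q)) (insert (f a) K))
          (B' := insert (f (a + l)) (insert (f (a + q)) (insert (f a) K)))
          (by ext x; simp) (by ext x; simp) (by simp)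
        have p3 := p1.symm.frame' (s' := s0 + k * b + (j + 1)) {f (a + l)}
          (A' := insert (f (a + l)) (insert (f (a + q)) (insert (f a) K)))
          (B' := insert (f (a + l)) (insert (f a) K))
          (by ext x; simp; tauto) (by ext x; simp; tauto) (by simp)
        refine (((p1.weaken (by omega) le_rfl).trans p2').trans p3).weaken le_rfl ?_
        apply le_of_eq
        ring
    intro a l ha hl hlb
    refine (inner b a l ha hl (by rwa [pow_succ, mul_comm] at hlb)).weaken ?_ ?_
    · apply le_of_eq; ring
    · apply le_of_eq; ring

end Peb
end PebLemmas

/-- Predecessors in the bit reversal graph on `2 * 2 ^ m` vertices. -/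
def brPred (m : ℕ) (v : Fin (2 * 2 ^ m)) : Finset (Fin (2 * 2 ^ m)) :=
  Finset.univ.filter (fun u => u.val + 1 = v.val ∨
    (2 ^ m ≤ v.val ∧ u.val = bitrev m (v.val - 2 ^ m)))

instance brNeZero (m : ℕ) : NeZero (2 * 2 ^ m) := ⟨by positivity⟩

theorem brPred_lt (m : ℕ) (u v : Fin (2 * 2 ^ m)) (h : u ∈ brPred m v) : u < v := by
  simp only [brPred, Finset.mem_filter, Finset.mem_univ, true_and] at h
  have := bitrev_lt m (v.val - 2 ^ m)
  rw [Fin.lt_def]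
  omega

theorem brPred_card (m : ℕ) (v : Fin (2 * 2 ^ m)) : (brPred m v).card ≤ 2 := by
  refine (Finset.card_le_card (t := {Fin.ofNat _ (v.val - 1),
    Fin.ofNat _ (bitrev m (v.val - 2 ^ m))}) ?_).trans Finset.card_le_two
  intro u hu
  simp only [brPred, Finset.mem_filter, Finset.mem_univ, true_and] at hu
  simp only [Finset.mem_insert, Finset.mem_singleton, Fin.ext_iff, Fin.val_ofNat]
  have := u.2
  rcases hu with hu | hu
  · left
    have e : v.val - 1 = u.val := by omega
    rw [e, Nat.mod_eq_of_lt this]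
  · right
    rw [← hu.2, Nat.mod_eq_of_lt this]

set_option maxHeartbeats 1000000 in
/-- The reversible pebbling strategy for the bit reversal graph. -/
theorem br_upper (m q J b b2 k : ℕ) (hq : 1 ≤ q) (hJ : 2 ^ m ≤ (J + 1) * q) (hb : q ≤ b ^ k)
    (hJ' : J * q < 2 ^ m)
    (hb2 : 2 ^ m ≤ b2 ^ k) :
    ∃ B : Finset (Fin (2 * 2 ^ m)), Fin.ofNat _ (2 * 2 ^ m - 1) ∈ B ∧
      Peb (brPred m) ((J + 1) + 4 + k * b + k * b2)
        (1 + J * (2 * b) ^ k + (2 * b) ^ k + (2 * b2) ^ k * (2 * (2 * b) ^ k + 1)) ∅ B := by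
  set N := 2 ^ m with hN
  have hNpos : 1 ≤ N := Nat.one_le_two_pow
  set f : ℕ → Fin (2 * N) := fun i => Fin.ofNat _ i with hf
  have hfv : ∀ i, i < 2 * N → (f i).val = i := fun i hi => by
    simp [hf, Nat.mod_eq_of_lt hi]
  have hself : ∀ v : Fin (2 * N), f v.val = v := fun v => by
    ext; rw [hfv _ v.2]
  -- basic segments
  have seg : ∀ a l, a + l < N → l ≤ b ^ k → Peb (brPred m) (2 + k * b) ((2 * b) ^ k)
      {f a} {f (a + l), f a} := by
    intro a l hal hl
    have := Peb.path (pr := brPred m) f ∅ 2 1 0 (N - 1) (by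
      intro i _ hi
      refine Peb.add 0 _ _ _ (Peb.refl _ _ (by simp)) ?_ Finset.card_le_two
      intro u hu
      simp only [brPred, Finset.mem_filter, Finset.mem_univ, true_and] at hu
      rw [hfv (i + 1) (by omega)] at hu
      have hu' : u.val = i := by omega
      rw [← hself u, hu']
      simp) (by simp) b k a l (by omega) (by omega) hl
    simpa using this
  -- checkpoints
  set K : ℕ → Finset (Fin (2 * N)) := fun j => (Finset.range (j + 1)).image (fun i => f (i * q))
    with hK
  have hKc : ∀ j, (K j).card ≤ j + 1 := fun j =>
    Finset.card_image_le.trans (by simp)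
  have hKmem : ∀ j i, i ≤ j → f (i * q) ∈ K j := fun j i hi =>
    Finset.mem_image.mpr ⟨i, by simp; omega, rfl⟩
  have hKs : ∀ j, K (j + 1) = insert (f ((j + 1) * q)) (K j) := by
    intro j
    simp only [hK]
    rw [Finset.range_add_one (n := j + 1), Finset.image_insert]
  have hKP : ∀ j, j ≤ J → Peb (brPred m) ((J + 1) + 4 + k * b) (1 + j * (2 * b) ^ k) ∅ (K j) := by
    intro j
    induction j with
    | zero =>
      intro _
      have h0 : K 0 = insert (f 0) ∅ := by simp [hK]
      rw [h0]
      refine (Peb.add 0 _ _ _ (Peb.refl _ _ (by simp)) ?_ (by simp <;> omega)).weaken le_rfl (by omega)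
      intro u hu
      simp only [brPred, Finset.mem_filter, Finset.mem_univ, true_and] at hu
      rw [hfv 0 (by omega)] at hu
      omega
    | succ j ih =>
      intro hj
      have hjq : (j + 1) * q ≤ J * q := Nat.mul_le_mul_right _ hj
      have e : (j + 1) * q = j * q + q := by ring
      have p := seg (j * q) q (by omega) hb
      rw [← e] at p
      have hm := hKmem j j le_rfl
      have p' := p.frame' (s' := (J + 1) + 4 + k * b) (K j) (A' := K j) (B' := K (j + 1))
        (by ext x; simp; rintro rfl; exact hm)
        (by rw [hKs]; ext x; simp; constructor
            · rintro (h | rfl | h)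
              · exact Or.inl h
              · exact Or.inr hm
              · exact Or.inr h
            · rintro (h | h)
              · exact Or.inl h
              · exact Or.inr (Or.inr h))
        (by have := hKc j; omega)
      refine ((ih (by omega)).trans p').weaken le_rfl ?_
      apply le_of_eq; ring
  -- reach any point of the first path
  have reach : ∀ w < N, Peb (brPred m) ((J + 1) + 2 + k * b) ((2 * b) ^ k) (K J)
      (insert (f w) (K J)) := by
    intro w hw
    have h1 : w / q ≤ J := by
      have : w / q < J + 1 := by
        rw [Nat.div_lt_iff_lt_mul (by omega)]; omega
      omega
    have h2 : w / q * q + w % q = w := Nat.div_add_mod' w q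
    have h3 : w % q < q := Nat.mod_lt _ (by omega)
    have p := seg (w / q * q) (w % q) (by omega) (by omega)
    rw [h2] at p
    have hm := hKmem J (w / q) h1
    exact p.frame' (K J)
      (by ext x; simp; rintro rfl; exact hm)
      (by ext x; simp; constructor
          · rintro (h | rfl | h)
            · exact Or.inl h
            · exact Or.inr hm
            · exact Or.inr h
          · rintro (h | h)
            · exact Or.inl h
            · exact Or.inr (Or.inr h))
      (by have := hKc J; omega)
  have second := Peb.path (pr := brPred m) f (K J) ((J + 1) + 4 + k * b) (2 * (2 * b) ^ k + 1)
    (N - 1) (2 * N - 1) (by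
      intro i hi1 hi2
      set w := bitrev m (i + 1 - N) with hw
      have hwN : w < N := bitrev_lt _ _
      have p1 := (reach w hwN).frame' (s' := (J + 1) + 4 + k * b) {f i}
        (A' := insert (f i) (K J)) (B' := insert (f w) (insert (f i) (K J)))
        (by ext x; simp <;> tauto) (by ext x; simp <;> tauto) (by simp <;> omega)
      have hc : (insert (f (i + 1)) (insert (f w) (insert (f i) (K J)))).card ≤
          (J + 1) + 4 + k * b := by
        refine (Finset.card_insert_le _ _).trans ?_
        have a1 := Finset.card_insert_le (f w) (insert (f i) (K J))
        have a2 := Finset.card_insert_le (f i) (K J)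
        have := hKc J
        omega
      have p2 := Peb.add _ _ _ (f (i + 1)) p1 (by
        intro u hu
        simp only [brPred, Finset.mem_filter, Finset.mem_univ, true_and] at hu
        rw [hfv (i + 1) (by omega)] at hu
        rcases hu with hu | hu
        · have hu' : u.val = i := by omega
          rw [← hself u, hu']
          simp
        · rw [← hself u, hu.2]
          simp [hw, hN]) hc
      have p3 := (reach w hwN).symm.frame' (s' := (J + 1) + 4 + k * b) {f i, f (i + 1)}
        (A' := insert (f (i + 1)) (insert (f w) (insert (f i) (K J))))
        (B' := insert (f (i + 1)) (insert (f i) (K J)))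
        (by ext x; simp <;> tauto) (by ext x; simp <;> tauto)
        (by have := Finset.card_le_two (a := f i) (b := f (i + 1)); omega)
      refine (p2.trans p3).weaken le_rfl ?_
      apply le_of_eq; ring)
    (by have := hKc J; omega) b2 k (N - 1) N le_rfl (by omega) hb2
  refine ⟨insert (f (N - 1 + N)) (insert (f (N - 1)) (K J)), ?_, ?_⟩
  · have e : N - 1 + N = 2 * N - 1 := by omega
    rw [e]; exact Finset.mem_insert_self _ _
  · have := (((hKP J le_rfl).weaken (s' := (J + 1) + 4 + k * b + k * b2) (by omega) le_rfl).trans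
      ((reach (N - 1) (by omega)).weaken (by omega) le_rfl)).trans second
    exact this

/-- The clauses of the pebbling formula of a DAG. -/
def pebClauses {M : ℕ} (pr : Fin M → Finset (Fin M)) (z : Fin M) : Finset (Clause M) :=
  insert (∅, {z}) (Finset.univ.image fun v => ({v}, pr v))

/-- The pebbling formula of a DAG. -/
def pebCNF (M : ℕ) (pr : Fin M → Finset (Fin M)) (z : Fin M) : CNF where
  nvars := M
  clauses := pebClauses pr z

/-- The polynomials of the pebbling formula of a DAG. -/
noncomputable def pebPoly (F : Type) [Field F] {M : ℕ} (pr : Fin M → Finset (Fin M)) (z : Fin M) :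
    {C // C ∈ pebClauses pr z} → MvPolynomial (Fin M) F :=
  fun C => Clause.poly F C.1

section NS
variable {M : ℕ} {pr : Fin M → Finset (Fin M)} {z : Fin M}

theorem pebCNF_is3 (h2 : ∀ v, (pr v).card ≤ 2) : (pebCNF M pr z).Is3CNF := by
  have key : ∀ C ∈ pebClauses pr z, C.1.card + C.2.card ≤ 3 := by
    intro C hC
    simp only [pebClauses, Finset.mem_insert, Finset.mem_image, Finset.mem_univ, true_and] at hC
    rcases hC with rfl | ⟨v, rfl⟩
    · simp
    · have := h2 v
      simp only [Finset.card_singleton]; omega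
  exact key

theorem pebCNF_unsat (hlt : ∀ u v, u ∈ pr v → u < v) : (pebCNF M pr z).Unsat := by
  intro a
  by_contra hcon
  push Not at hcon
  change Fin M → Bool at a
  change ∀ C ∈ pebClauses pr z, Clause.Sat a C at hcon
  have key : ∀ n : ℕ, ∀ v : Fin M, v.val = n → a v = true := by
    intro n
    induction n using Nat.strong_induction_on with
    | _ n ih =>
      intro v hv
      have := hcon ({v}, pr v) (by simp [pebClauses])
      rcases this with ⟨x, hx, h⟩ | ⟨y, hy, h⟩
      · rw [Finset.mem_singleton.mp hx] at h; exact h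
      · have hlt' := hlt y v hy
        have := ih y.val (by rw [← hv]; exact hlt') y rfl
        have h' : a y = false := h
        rw [this] at h'
        cases h'
  rcases hcon (∅, {z}) (by simp [pebClauses]) with ⟨x, hx, h⟩ | ⟨y, hy, h⟩
  · simp at hx
  · have h' : a y = false := h
    rw [key _ y rfl] at h'
    cases h'

theorem pebCNF_card : (pebClauses pr z).card = M + 1 := by
  simp only [pebClauses]
  rw [Finset.card_insert_of_notMem, Finset.card_image_of_injective]
  · simp
  · intro u v h
    simpa using congrArg Prod.fst h
  · simp

/-- index of the clause of vertex `v` -/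
def vIdx (pr : Fin M → Finset (Fin M)) (z v : Fin M) : {C // C ∈ pebClauses pr z} :=
  ⟨(({v} : Finset (Fin M)), pr v), by simp [pebClauses]⟩

/-- index of the sink clause -/
def zIdx (pr : Fin M → Finset (Fin M)) (z : Fin M) : {C // C ∈ pebClauses pr z} :=
  ⟨((∅ : Finset (Fin M)), {z}), by simp [pebClauses]⟩

theorem idx_cases (i : {C // C ∈ pebClauses pr z}) :
    i = zIdx pr z ∨ ∃ v, i = vIdx pr z v := by
  obtain ⟨C, hC⟩ := i
  have hC' := hC
  simp only [pebClauses, Finset.mem_insert, Finset.mem_image, Finset.mem_univ, true_and] at hC'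
  rcases hC' with rfl | ⟨v, rfl⟩
  · left; rfl
  · right; exact ⟨v, rfl⟩

variable (F : Type) [Field F]

/-- the exponent vector of a set -/
noncomputable def expo (A : Finset (Fin M)) : Fin M →₀ ℕ := ∑ x ∈ A, Finsupp.single x 1

/-- the multilinear monomial of a set -/
noncomputable def mon (A : Finset (Fin M)) : MvPolynomial (Fin M) F := monomial (expo A) 1

theorem mon_eq (A : Finset (Fin M)) : mon F A = ∏ x ∈ A, X x := by
  rw [mon, expo]
  exact (MvPolynomial.monomial_sum_one A (fun x => Finsupp.single x 1))

theorem expo_apply (A : Finset (Fin M)) (x : Fin M) : expo A x = if x ∈ A then 1 else 0 := by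
  simp [expo, Finsupp.finsetSum_apply, Finsupp.single_apply]

theorem expo_support (A : Finset (Fin M)) : (expo A).support = A := by
  ext x; simp [expo_apply]

theorem expo_inj {A B : Finset (Fin M)} (h : expo A = expo B) : A = B := by
  rw [← expo_support A, h, expo_support]

theorem expo_degree (A : Finset (Fin M)) : ((expo A).sum fun _ e => e) = A.card := by
  rw [Finsupp.sum, expo_support, Finset.card_eq_sum_ones]
  exact Finset.sum_congr rfl (fun x hx => by simp [expo_apply, hx])

theorem mon_degree (A : Finset (Fin M)) : (mon F A).totalDegree = A.card := by
  rw [mon, totalDegree_monomial _ one_ne_zero, expo_degree]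

theorem poly_z : pebPoly F pr z (zIdx pr z) = mon F {z} := by
  simp [pebPoly, Clause.poly, zIdx, mon_eq]

theorem poly_v (v : Fin M) (hv : v ∉ pr v) :
    pebPoly F pr z (vIdx pr z v) = mon F (pr v) - mon F (insert v (pr v)) := by
  simp only [pebPoly, Clause.poly, vIdx, mon_eq, Finset.prod_singleton]
  rw [Finset.prod_insert hv]
  ring

theorem poly_card (hlt : ∀ v, v ∉ pr v) (i) : (pebPoly F pr z i).support.card ≤ 2 := by
  rcases idx_cases i with rfl | ⟨v, rfl⟩
  · rw [poly_z, mon]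
    refine (Finset.card_le_card support_monomial_subset).trans (by simp)
  · rw [poly_v F v (hlt v)]
    refine (Finset.card_le_card (support_sub _ _ _)).trans ?_
    refine (Finset.card_union_le _ _).trans ?_
    have h1 := Finset.card_le_card (support_monomial_subset (s := expo (pr v)) (a := (1 : F)))
    have h2 := Finset.card_le_card
      (support_monomial_subset (s := expo (insert v (pr v))) (a := (1 : F)))
    simp only [Finset.card_singleton] at h1 h2
    simp only [mon]
    omega

theorem poly_v_degree (v : Fin M) (hv : v ∉ pr v) :
    (pebPoly F pr z (vIdx pr z v)).totalDegree = (pr v).card + 1 := by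
  apply le_antisymm
  · rw [poly_v F v hv]
    refine (totalDegree_sub _ _).trans ?_
    rw [mon_degree, mon_degree, Finset.card_insert_of_notMem hv]
    simp
  · rw [← Finset.card_insert_of_notMem hv, ← expo_degree]
    apply le_totalDegree
    rw [poly_v F v hv, mem_support_iff, coeff_sub, mon, mon, coeff_monomial, coeff_monomial]
    rw [if_neg, if_pos rfl]
    · simp
    · intro h
      have := expo_inj h
      exact hv (this ▸ Finset.mem_insert_self v (pr v))

theorem mon_mul (A B : Finset (Fin M)) (h : Disjoint A B) : mon F A * mon F B = mon F (A ∪ B) := by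
  rw [mon_eq, mon_eq, mon_eq, Finset.prod_union h]

theorem mon_sdiff_mul (A B : Finset (Fin M)) (h : B ⊆ A) :
    mon F (A \ B) * mon F B = mon F A := by
  rw [mon_mul F _ _ Finset.sdiff_disjoint, Finset.sdiff_union_of_subset h]

/-- one move as a Nullstellensatz term -/
theorem move_eq (A : Finset (Fin M)) (v : Fin M) (hv : v ∉ pr v) (hA : pr v ⊆ A) (hvA : v ∉ A) :
    mon F (A \ pr v) * pebPoly F pr z (vIdx pr z v) = mon F A - mon F (insert v A) := by
  rw [poly_v F v hv, mul_sub, mon_sdiff_mul F _ _ hA]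
  congr 1
  rw [mon_mul]
  · congr 1
    ext x
    simp only [Finset.mem_union, Finset.mem_sdiff, Finset.mem_insert]
    have := @hA x
    tauto
  · rw [Finset.disjoint_left]
    intro x hx hx'
    simp only [Finset.mem_sdiff, Finset.mem_insert] at hx hx'
    rcases hx' with rfl | h
    · exact hvA hx.1
    · exact hx.2 h

/-- adding a monomial term to a certificate -/
theorem add_term (r : {C // C ∈ pebClauses pr z} → MvPolynomial (Fin M) F)
    (i0 : {C // C ∈ pebClauses pr z}) (e : Fin M →₀ ℕ) (c : F) (t s : ℕ)
    (hr : ∑ i, (r i).support.card ≤ t)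
    (hd : ∀ i, (r i * pebPoly F pr z i).totalDegree ≤ s)
    (hd0 : (monomial e c * pebPoly F pr z i0).totalDegree ≤ s) :
    ∃ r' : {C // C ∈ pebClauses pr z} → MvPolynomial (Fin M) F,
      ∑ i, r' i * pebPoly F pr z i =
        ∑ i, r i * pebPoly F pr z i + monomial e c * pebPoly F pr z i0 ∧
      ∑ i, (r' i).support.card ≤ t + 1 ∧
      ∀ i, (r' i * pebPoly F pr z i).totalDegree ≤ s := by
  classical
  refine ⟨fun i => r i + if i = i0 then monomial e c else 0, ?_, ?_, ?_⟩
  · simp only [add_mul, Finset.sum_add_distrib, ite_mul, zero_mul]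
    congr 1
    rw [Finset.sum_ite_eq' Finset.univ i0
      (fun i => monomial e c * pebPoly F pr z i)]
    simp
  · have : ∀ i, (r i + if i = i0 then monomial e c else 0).support.card ≤
        (r i).support.card + if i = i0 then 1 else 0 := by
      intro i
      refine (Finset.card_le_card support_add).trans ((Finset.card_union_le _ _).trans ?_)
      apply Nat.add_le_add_left
      split_ifs
      · exact (Finset.card_le_card support_monomial_subset).trans (by simp)
      · simp
    refine (Finset.sum_le_sum (fun i _ => this i)).trans ?_
    rw [Finset.sum_add_distrib]
    simp only [Finset.sum_ite_eq', Finset.mem_univ, if_true]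
    omega
  · intro i
    rw [add_mul]
    refine (totalDegree_add _ _).trans (max_le (hd i) ?_)
    split_ifs with h
    · rw [h]; exact hd0
    · simp

theorem card_move (A : Finset (Fin M)) (v : Fin M) (hv : v ∉ pr v) (hA : pr v ⊆ A) (hvA : v ∉ A)
    (s : ℕ) (hc : (insert v A).card ≤ s) (c : F) :
    (monomial (expo (A \ pr v)) c * pebPoly F pr z (vIdx pr z v)).totalDegree ≤ s := by
  refine (totalDegree_mul _ _).trans ?_
  rw [poly_v_degree F v hv]
  have h1 := totalDegree_monomial_le (expo (A \ pr v)) c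
  rw [Finset.card_insert_of_notMem hvA] at hc
  have h2 := Finset.card_sdiff_add_card_eq_card hA
  have h3 : ((expo (A \ pr v)).sum fun _ => id) = (A \ pr v).card := expo_degree _
  omega

/-- reversible pebblings give Nullstellensatz derivations -/
theorem peb_to_ns (hlt : ∀ v, v ∉ pr v) {s t : ℕ} {A B : Finset (Fin M)} (h : Peb pr s t A B) :
    ∃ r : {C // C ∈ pebClauses pr z} → MvPolynomial (Fin M) F,
      ∑ i, r i * pebPoly F pr z i = mon F A - mon F B ∧
      ∑ i, (r i).support.card ≤ t ∧
      ∀ i, (r i * pebPoly F pr z i).totalDegree ≤ s := by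
  induction h with
  | refl t A hA => exact ⟨fun _ => 0, by simp, by simp, by simp⟩
  | add t A B v h hp hc ih =>
    obtain ⟨r, h1, h2, h3⟩ := ih
    by_cases hvB : v ∈ B
    · rw [Finset.insert_eq_of_mem hvB]
      exact ⟨r, h1, by omega, h3⟩
    · obtain ⟨r', e1, e2, e3⟩ := add_term F r (vIdx pr z v) (expo (B \ pr v)) 1 t s h2 h3
        (card_move F B v (hlt v) hp hvB s hc 1)
      refine ⟨r', ?_, e2, e3⟩
      have := move_eq (z := z) F B v (hlt v) hp hvB
      rw [mon] at this
      rw [e1, h1, this]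
      ring
  | rem t A B v h hp hc ih =>
    obtain ⟨r, h1, h2, h3⟩ := ih
    by_cases hvB : v ∈ B
    · rw [Finset.insert_eq_of_mem hvB] at h1
      exact ⟨r, h1, by omega, h3⟩
    · obtain ⟨r', e1, e2, e3⟩ := add_term F r (vIdx pr z v) (expo (B \ pr v)) (-1) t s h2 h3
        (card_move F B v (hlt v) hp hvB s hc (-1))
      refine ⟨r', ?_, e2, e3⟩
      have := move_eq (z := z) F B v (hlt v) hp hvB
      rw [mon] at this
      rw [e1, h1, map_neg, neg_mul, this]
      ring

theorem ns_upper (hlt : ∀ v, v ∉ pr v) {s t : ℕ} {B : Finset (Fin M)} (h : Peb pr s t ∅ B)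
    (hB : B.card ≤ s) (hz : z ∈ B) :
    ∃ r sj, IsNSCert (pebPoly F pr z) r sj ∧
      nsDegree (pebPoly F pr z) r sj ≤ s ∧
      nsSize (pebPoly F pr z) r sj ≤ 2 * (t + 1) := by
  obtain ⟨r, h1, h2, h3⟩ := peb_to_ns (z := z) F hlt h
  obtain ⟨r', e1, e2, e3⟩ := add_term F r (zIdx pr z) (expo (B \ {z})) 1 t s h2 h3 (by
    have : monomial (expo (B \ {z})) (1 : F) = mon F (B \ {z}) := rfl
    rw [this, poly_z, mon_sdiff_mul F _ _ (by simpa using hz), mon_degree]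
    exact hB)
  refine ⟨r', fun _ => 0, ?_, ?_, ?_⟩
  · have : monomial (expo (B \ {z})) (1 : F) = mon F (B \ {z}) := rfl
    rw [this, poly_z, mon_sdiff_mul F _ _ (by simpa using hz), h1] at e1
    have h0 : mon F (∅ : Finset (Fin M)) = 1 := by simp [mon_eq]
    rw [h0] at e1
    simp only [IsNSCert, zero_mul, Finset.sum_const_zero, add_zero]
    refine e1.trans ?_
    ring
  · refine max_le ?_ ?_
    · exact Finset.sup_le (fun i _ => e3 i)
    · simp
  · simp only [nsSize, support_zero, Finset.card_empty, mul_zero, Finset.sum_const_zero, add_zero]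
    calc _ ≤ ∑ i, (r' i).support.card * 2 :=
          Finset.sum_le_sum (fun i _ => Nat.mul_le_mul_left _ (poly_card F hlt i))
      _ = (∑ i, (r' i).support.card) * 2 := by rw [Finset.sum_mul]
      _ ≤ (t + 1) * 2 := Nat.mul_le_mul_right _ e2
      _ = _ := by ring

theorem vIdx_inj : Function.Injective (vIdx pr z) := by
  intro u v h
  have := congrArg (fun i => i.1.1) h
  simpa [vIdx] using this

/-- Nullstellensatz refutations give reversible pebblings. -/
theorem ns_lower (hlt : ∀ v, v ∉ pr v)
    (r : {C // C ∈ pebClauses pr z} → MvPolynomial (Fin M) F) (sj : Fin M → MvPolynomial (Fin M) F)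
    (hcert : IsNSCert (pebPoly F pr z) r sj) (d : ℕ)
    (hdeg : nsDegree (pebPoly F pr z) r sj ≤ d) :
    ∃ (T : ℕ) (c : ℕ → Finset (Fin M)), T ≤ nsSize (pebPoly F pr z) r sj ∧ c 0 = ∅ ∧ z ∈ c T ∧
      (∀ t ≤ T, (c t).card ≤ d) ∧
      ∀ t < T, ∃ v, pr v ⊆ c t ∧ (c (t + 1) = insert v (c t) ∨ c t = insert v (c (t + 1))) := by
  classical
  set E : Finset (Sym2 (Finset (Fin M))) := Finset.univ.biUnion fun v =>
    (r (vIdx pr z v)).support.image fun m => s(m.support ∪ pr v, insert v (m.support ∪ pr v)) with hE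
  have hpne : ∀ v, pebPoly F pr z (vIdx pr z v) ≠ 0 := by
    intro v h0
    have := poly_v_degree (z := z) F v (hlt v)
    rw [h0] at this
    simp at this
  have hpne' : ∀ i, pebPoly F pr z i ≠ 0 := by
    intro i
    rcases idx_cases i with rfl | ⟨v, rfl⟩
    · rw [poly_z, mon]; simp
    · exact hpne v
  have hEcard : E.card ≤ nsSize (pebPoly F pr z) r sj := by
    calc E.card ≤ ∑ v, ((r (vIdx pr z v)).support.image fun m =>
            s(m.support ∪ pr v, insert v (m.support ∪ pr v))).card := Finset.card_biUnion_le
      _ ≤ ∑ v, (r (vIdx pr z v)).support.card :=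
          Finset.sum_le_sum (fun v _ => Finset.card_image_le)
      _ = ∑ i ∈ Finset.univ.image (vIdx pr z), (r i).support.card := by
          rw [Finset.sum_image (fun a _ b _ h => vIdx_inj h)]
      _ ≤ ∑ i, (r i).support.card :=
          Finset.sum_le_sum_of_subset (Finset.subset_univ _)
      _ ≤ ∑ i, (r i).support.card * (pebPoly F pr z i).support.card := by
          refine Finset.sum_le_sum (fun i _ => Nat.le_mul_of_pos_right _ ?_)
          rw [Finset.card_pos, Finset.nonempty_iff_ne_empty]
          intro h
          exact hpne' i (support_eq_empty.mp h)
      _ ≤ _ := Nat.le_add_right _ _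
  set G : SimpleGraph (Finset (Fin M)) := SimpleGraph.fromEdgeSet (E : Set _) with hG
  -- edges are moves of small cardinality
  have hmov : ∀ A B, G.Adj A B → A.card ≤ d ∧ B.card ≤ d ∧
      ∃ v, pr v ⊆ A ∧ (B = insert v A ∨ A = insert v B) := by
    intro A B hAB
    rw [hG, SimpleGraph.fromEdgeSet_adj] at hAB
    have hmem := hAB.1
    simp only [hE, Finset.coe_biUnion, Finset.coe_univ, Set.mem_univ, Set.iUnion_true,
      Set.mem_iUnion, Finset.coe_image, Set.mem_image, Finset.mem_coe] at hmem
    obtain ⟨v, m, hm, heq⟩ := hmem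
    have hrne : r (vIdx pr z v) ≠ 0 := by
      intro h0; rw [h0] at hm; simp at hm
    have h1 : (r (vIdx pr z v) * pebPoly F pr z (vIdx pr z v)).totalDegree ≤ d := by
      refine le_trans ?_ hdeg
      refine le_trans ?_ (le_max_left _ _)
      exact Finset.le_sup (f := fun i => (r i * pebPoly F pr z i).totalDegree)
        (Finset.mem_univ (vIdx pr z v))
    rw [totalDegree_mul_of_isDomain hrne (hpne v), poly_v_degree F v (hlt v)] at h1
    have h2 := le_totalDegree hm
    have h3 : m.support.card ≤ m.sum fun _ e => e := by
      rw [Finsupp.sum, Finset.card_eq_sum_ones]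
      refine Finset.sum_le_sum (fun x hx => ?_)
      rw [Finsupp.mem_support_iff] at hx
      omega
    have h4 := Finset.card_union_le m.support (pr v)
    have h5 := Finset.card_insert_le v (m.support ∪ pr v)
    have hsub : pr v ⊆ m.support ∪ pr v := Finset.subset_union_right
    rw [Sym2.eq_iff] at heq
    rcases heq with ⟨rfl, rfl⟩ | ⟨rfl, rfl⟩
    · exact ⟨by omega, by omega, v, hsub, Or.inl rfl⟩
    · exact ⟨by omega, by omega, v, hsub.trans (Finset.subset_insert _ _), Or.inr rfl⟩
  -- the linear functional
  have hreach : ∃ B, G.Reachable ∅ B ∧ z ∈ B := by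
    by_contra hcon
    push Not at hcon
    set L : MvPolynomial (Fin M) F →ₗ[F] F := (basisMonomials (Fin M) F).constr F
      (fun m => if G.Reachable ∅ m.support then (1 : F) else 0) with hL
    have hL1 : ∀ m a, L (monomial m a) = a * if G.Reachable ∅ m.support then (1 : F) else 0 := by
      intro m a
      have e : monomial m a = a • (basisMonomials (Fin M) F m) := by
        rw [coe_basisMonomials, smul_monomial, smul_eq_mul, mul_one]
      rw [e, map_smul, hL, Module.Basis.constr_basis, smul_eq_mul]
    have hmul : ∀ (q p : MvPolynomial (Fin M) F),
        (∀ m ∈ q.support, L (monomial m (coeff m q) * p) = 0) → L (q * p) = 0 := by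
      intro q p h
      conv_lhs => rw [← support_sum_monomial_coeff q]
      rw [Finset.sum_mul, map_sum]
      exact Finset.sum_eq_zero h
    have hsupp : ∀ (m : Fin M →₀ ℕ) (A : Finset (Fin M)), (m + expo A).support = m.support ∪ A := by
      intro m A
      ext x
      simp only [Finsupp.mem_support_iff, Finsupp.add_apply, expo_apply, Finset.mem_union]
      split_ifs with h <;> simp [h]
    have hLz : L (r (zIdx pr z) * pebPoly F pr z (zIdx pr z)) = 0 := by
      refine hmul _ _ (fun m _ => ?_)
      rw [poly_z, mon, monomial_mul, hL1, hsupp, if_neg, mul_zero]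
      intro h
      exact hcon _ h (by simp)
    have hLv : ∀ v, L (r (vIdx pr z v) * pebPoly F pr z (vIdx pr z v)) = 0 := by
      intro v
      refine hmul _ _ (fun m hm => ?_)
      rw [poly_v F v (hlt v), mul_sub, map_sub, mon, mon, monomial_mul, monomial_mul, hL1, hL1,
        hsupp, hsupp, Finset.union_insert]
      have hiff : G.Reachable ∅ (m.support ∪ pr v) ↔
          G.Reachable ∅ (insert v (m.support ∪ pr v)) := by
        by_cases heq : m.support ∪ pr v = insert v (m.support ∪ pr v)
        · rw [← heq]
        · have hadj : G.Adj (m.support ∪ pr v) (insert v (m.support ∪ pr v)) := by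
            rw [hG, SimpleGraph.fromEdgeSet_adj]
            refine ⟨?_, heq⟩
            rw [Finset.mem_coe, hE, Finset.mem_biUnion]
            exact ⟨v, Finset.mem_univ _, Finset.mem_image.mpr ⟨m, hm, rfl⟩⟩
          exact ⟨fun h => h.trans hadj.reachable, fun h => h.trans hadj.symm.reachable⟩
      simp only [hiff, sub_self]
    have hLs : ∀ j, L (sj j * (X j ^ 2 - X j)) = 0 := by
      intro j
      refine hmul _ _ (fun m _ => ?_)
      have e1 : (X j : MvPolynomial (Fin M) F) ^ 2 = monomial (Finsupp.single j 2) 1 := by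
        rw [X_pow_eq_monomial]
      have e2 : (X j : MvPolynomial (Fin M) F) = monomial (Finsupp.single j 1) 1 := rfl
      rw [e1, e2, mul_sub, map_sub, monomial_mul, monomial_mul, hL1, hL1]
      have e3 : (m + Finsupp.single j 2).support = (m + Finsupp.single j 1).support := by
        ext x
        simp only [Finsupp.mem_support_iff, Finsupp.add_apply, Finsupp.single_apply]
        split_ifs <;> simp
      rw [e3, sub_self]
    have hone : L 1 = 1 := by
      have : (1 : MvPolynomial (Fin M) F) = monomial 0 1 := rfl
      rw [this, hL1]
      simp
    have hfin := congrArg L hcert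
    rw [map_add, map_sum, map_sum, hone] at hfin
    rw [Finset.sum_eq_zero, Finset.sum_eq_zero] at hfin
    · simp at hfin
    · intro j _; exact hLs j
    · intro i _
      rcases idx_cases i with rfl | ⟨v, rfl⟩
      · exact hLz
      · exact hLv v
  obtain ⟨B, hB, hzB⟩ := hreach
  obtain ⟨p, hp⟩ := hB.exists_isPath
  have hlen : p.length ≤ E.card := by
    rw [← p.length_edges, ← List.toFinset_card_of_nodup hp.isTrail.edges_nodup]
    apply Finset.card_le_card
    intro e he
    rw [List.mem_toFinset] at he
    have := p.edges_subset_edgeSet he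
    rw [hG, SimpleGraph.edgeSet_fromEdgeSet] at this
    exact this.1
  refine ⟨p.length, p.getVert, hlen.trans hEcard, p.getVert_zero, ?_, ?_, ?_⟩
  · rw [p.getVert_length]; exact hzB
  · intro t ht
    rcases Nat.eq_zero_or_pos t with rfl | hpos
    · rw [p.getVert_zero]; simp
    · obtain ⟨k, rfl⟩ : ∃ k, t = k + 1 := ⟨t - 1, by omega⟩
      exact (hmov _ _ (p.adj_getVert_succ (i := k) (by omega))).2.1
  · intro t ht
    exact (hmov _ _ (p.adj_getVert_succ ht)).2.2

end NS

theorem Peb.card_le {V : Type} [DecidableEq V] {pr : V → Finset V} {s t : ℕ} {A B : Finset V}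
    (h : Peb pr s t A B) : B.card ≤ s := by
  cases h with
  | refl _ _ hA => exact hA
  | add _ _ _ v h hp hc => exact hc
  | rem _ _ _ v h hp hc => exact (Finset.card_le_card (Finset.subset_insert _ _)).trans hc

/-- the sink of the bit reversal graph -/
def brSink (m : ℕ) : Fin (2 * 2 ^ m) := Fin.ofNat _ (2 * 2 ^ m - 1)

theorem brPred_irrefl (m : ℕ) (v : Fin (2 * 2 ^ m)) : v ∉ brPred m v := fun h =>
  lt_irrefl _ (brPred_lt m v v h)

theorem br_lower (F : Type) [Field F] (m d : ℕ) (hd : 1 ≤ d)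
    (r : {C // C ∈ pebClauses (brPred m) (brSink m)} → MvPolynomial (Fin (2 * 2 ^ m)) F)
    (sj : Fin (2 * 2 ^ m) → MvPolynomial (Fin (2 * 2 ^ m)) F)
    (hcert : IsNSCert (pebPoly F (brPred m) (brSink m)) r sj)
    (hdeg : nsDegree (pebPoly F (brPred m) (brSink m)) r sj ≤ d) :
    2 ^ m * 2 ^ m ≤ 16 * (d * nsSize (pebPoly F (brPred m) (brSink m)) r sj) := by
  obtain ⟨T, c, hT, h0, hz, hcard, hstep⟩ := ns_lower F (brPred_irrefl m) r sj hcert d hdeg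
  have hNpos : 1 ≤ 2 ^ m := Nat.one_le_two_pow
  set pr' : ℕ → ℕ → Prop := fun u v => u + 1 = v ∨ (2 ^ m ≤ v ∧ u = bitrev m (v - 2 ^ m)) with hpr'
  have hadd : ∀ t < T, ∀ x, x ∉ c t → x ∈ c (t + 1) →
      brPred m x ⊆ c t ∧ c (t + 1) = insert x (c t) := by
    intro t ht x hx hx'
    obtain ⟨v, hv, h | h⟩ := hstep t ht
    · rw [h, Finset.mem_insert] at hx'
      rcases hx' with rfl | hx'
      · exact ⟨hv, h⟩
      · exact absurd hx' hx
    · exact absurd (h ▸ Finset.mem_insert_of_mem hx') hx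
  have hmem : ∀ t (x : Fin (2 * 2 ^ m)), x.val ∈ (c t).image Fin.val ↔ x ∈ c t := by
    intro t x
    rw [Finset.mem_image]
    constructor
    · rintro ⟨y, hy, hyx⟩
      rwa [← Fin.ext hyx]
    · intro hx; exact ⟨x, hx, rfl⟩
  have hget : ∀ t v, v ∈ (c t).image Fin.val → ∃ x : Fin (2 * 2 ^ m), x.val = v := by
    intro t v hv
    obtain ⟨x, _, hx⟩ := Finset.mem_image.mp hv
    exact ⟨x, hx⟩
  have run : PebRun pr' (fun t => (c t).image Fin.val) T d := by
    refine ⟨by simp [h0], fun t ht => Finset.card_image_le.trans (hcard t ht), ?_, ?_⟩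
    · intro t ht v hv hv' u hu
      obtain ⟨x, rfl⟩ := hget _ _ hv'
      rw [hmem] at hv hv'
      have hsub := (hadd t ht x hv hv').1
      have hlt := bitrev_lt m (x.val - 2 ^ m)
      have hx := x.2
      have hu2 : u < 2 * 2 ^ m := by
        rcases hu with hu | hu <;> omega
      have : (⟨u, hu2⟩ : Fin (2 * 2 ^ m)) ∈ brPred m x := by
        simp only [brPred, Finset.mem_filter, Finset.mem_univ, true_and]
        exact hu
      exact (hmem t ⟨u, hu2⟩).mpr (hsub this)
    · intro t ht v w hv hv' hw hw'
      obtain ⟨x, rfl⟩ := hget _ _ hv'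
      obtain ⟨y, rfl⟩ := hget _ _ hw'
      rw [hmem] at hv hv' hw hw'
      have e := (hadd t ht x hv hv').2
      rw [e, Finset.mem_insert] at hw'
      rcases hw' with rfl | hw'
      · rfl
      · exact absurd hw' hw
  have hprs : ∀ u, pr' u (u + 1) := fun u => Or.inl rfl
  have hzv : (brSink m).val = 2 * 2 ^ m - 1 := by
    simp only [brSink, Fin.val_ofNat]
    exact Nat.mod_eq_of_lt (by omega)
  have hz' : 2 * 2 ^ m - 1 ∈ (c T).image Fin.val := by
    rw [← hzv, hmem]; exact hz
  have key : 2 ^ m * 2 ^ m ≤ 16 * (d * T) := by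
    set j := Nat.log 2 (4 * d) + 1 with hj
    have hj1 : 4 * d < 2 ^ j := Nat.lt_pow_succ_log_self (by norm_num) _
    have hj2 : 2 ^ j ≤ 8 * d := by
      have := Nat.pow_log_le_self 2 (x := 4 * d) (by omega)
      rw [hj, pow_succ]; omega
    by_cases hjm : j ≤ m
    · obtain ⟨l, rfl⟩ : ∃ l, m = j + l := ⟨m - j, by omega⟩
      have hl := run.lower (j := j) (l := l) hprs (fun i => Or.inr ⟨by omega, by simp⟩) hz'
      have h1 : 2 ^ j ≤ 2 * (2 ^ j - 1 - d) := by omega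
      rw [pow_add]
      generalize 2 ^ j - 1 - d = w at *
      generalize 2 ^ j = x at *
      generalize 2 ^ l = y at *
      calc x * y * (x * y) ≤ (8 * d) * y * ((2 * w) * y) := by gcongr
        _ = 16 * (d * (y * (w * y))) := by ring
        _ ≤ 16 * (d * T) := by gcongr
    · have hT2 := run.trivial_lower hprs _ hz'
      have h1 : 2 ^ (m + 1) ≤ 2 ^ j := Nat.pow_le_pow_right (by norm_num) (by omega)
      have h2 : 2 ^ m ≤ 4 * d := by rw [pow_succ] at h1; omega
      have h3 : 2 ^ m ≤ T := by omega
      calc 2 ^ m * 2 ^ m ≤ (4 * d) * T := by gcongr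
        _ ≤ 16 * (d * T) := by nlinarith [Nat.zero_le (d * T)]
  refine key.trans ?_
  gcongr

theorem root_bound (k q D : ℕ) (hk : 1 ≤ k) (hq : 1 ≤ q) (hD : q ≤ D ^ k) :
    ∃ b, q ≤ b ^ k ∧ b ^ k ≤ 2 ^ k * q ∧ b ≤ D := by
  have ex : ∃ b, q ≤ b ^ k := ⟨D, hD⟩
  classical
  refine ⟨Nat.find ex, Nat.find_spec ex, ?_, Nat.find_min' ex hD⟩
  set b := Nat.find ex with hb
  rcases Nat.lt_or_ge b 2 with h | h
  · calc b ^ k ≤ 1 ^ k := Nat.pow_le_pow_left (by omega) k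
      _ = 1 := one_pow k
      _ ≤ 2 ^ k * q := Nat.mul_pos (by positivity) hq
  · have hmin : ¬ q ≤ (b - 1) ^ k := Nat.find_min ex (by omega)
    calc b ^ k ≤ (2 * (b - 1)) ^ k := Nat.pow_le_pow_left (by omega) k
      _ = 2 ^ k * (b - 1) ^ k := mul_pow _ _ _
      _ ≤ 2 ^ k * q := Nat.mul_le_mul_left _ (by omega)

set_option maxHeartbeats 1000000 in
theorem br_ns_upper (F : Type) [Field F] (m n d k : ℕ) (hk : 1 ≤ k) (hd : 1 ≤ d) (hdn : d ≤ n)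
    (hmn : 2 ^ m ≤ n) (hnd : n ≤ d ^ k) :
    ∃ r sj, IsNSCert (pebPoly F (brPred m) (brSink m)) r sj ∧
      nsDegree (pebPoly F (brPred m) (brSink m)) r sj ≤ (5 + 3 * k) * d ∧
      d * nsSize (pebPoly F (brPred m) (brSink m)) r sj ≤ 18 * (4 ^ k) ^ 2 * n ^ 2 := by
  have hNpos : 1 ≤ 2 ^ m := Nat.one_le_two_pow
  set N := 2 ^ m with hN
  set q := N / d + 1 with hq
  have hq1 : 1 ≤ q := Nat.le_add_left _ _
  set J := (N - 1) / q with hJ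
  have hJq : J * q ≤ N - 1 := Nat.div_mul_le_self _ _
  have hJq2 : N - 1 < (J + 1) * q := by
    rw [mul_comm]; exact Nat.lt_mul_div_succ _ hq1
  have hqd : q * d ≤ N + d := by
    rw [hq, add_mul, one_mul]
    exact Nat.add_le_add_right (Nat.div_mul_le_self _ _) _
  have hNqd : N < d * q := Nat.lt_mul_div_succ _ hd
  have hJd : J < d := by
    by_contra hcon
    have : d * q ≤ J * q := Nat.mul_le_mul_right _ (by omega)
    omega
  have hqN : q ≤ N + 1 := by
    have := Nat.div_le_self N d
    omega
  obtain ⟨b, hb1, hb2, hb3⟩ := root_bound k q (2 * d) hk hq1 (by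
    rw [mul_pow]
    have : 2 ≤ 2 ^ k := by
      calc 2 = 2 ^ 1 := rfl
        _ ≤ 2 ^ k := Nat.pow_le_pow_right (by norm_num) hk
    have : 2 * d ^ k ≤ 2 ^ k * d ^ k := Nat.mul_le_mul_right _ this
    omega)
  obtain ⟨b', hb1', hb2', hb3'⟩ := root_bound k N d hk hNpos (by omega)
  obtain ⟨B, hzB, hP⟩ := br_upper m q J b b' k hq1 (by omega) hb1 (by omega) hb1'
  obtain ⟨r, sj, hc, hdg, hsz⟩ := ns_upper (z := brSink m) F (brPred_irrefl m) hP hP.card_le hzB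
  refine ⟨r, sj, hc, hdg.trans ?_, ?_⟩
  · have h1 : k * b ≤ k * (2 * d) := Nat.mul_le_mul_left _ hb3
    have h2 : k * b' ≤ k * d := Nat.mul_le_mul_left _ hb3'
    nlinarith
  · set A := 4 ^ k with hA
    have hA1 : 1 ≤ A := Nat.one_le_pow _ _ (by norm_num)
    have hAA : A = 2 ^ k * 2 ^ k := by rw [hA, ← mul_pow]; norm_num
    have hX : (2 * b) ^ k ≤ A * q := by
      rw [mul_pow, hAA, mul_assoc]; exact Nat.mul_le_mul_left _ hb2
    have hY : (2 * b') ^ k ≤ A * n := by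
      rw [mul_pow, hAA, mul_assoc]
      exact Nat.mul_le_mul_left _ (hb2'.trans (Nat.mul_le_mul_left _ hmn))
    set X := (2 * b) ^ k
    set Y := (2 * b') ^ k
    have hXd : d * X ≤ A * (2 * n) := by
      calc d * X ≤ d * (A * q) := Nat.mul_le_mul_left _ hX
        _ = A * (q * d) := by ring
        _ ≤ A * (2 * n) := Nat.mul_le_mul_left _ (by omega)
    have hn1 : 1 ≤ n := by omega
    have t1 : (J + 1) * (d * X) ≤ n * (A * (2 * n)) := Nat.mul_le_mul (by omega) hXd
    have t2 : Y * (2 * (d * X) + d) ≤ (A * n) * (2 * (A * (2 * n)) + n) :=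
      Nat.mul_le_mul hY (by omega)
    have t3 : n ≤ n ^ 2 := Nat.le_self_pow (by norm_num) n
    have t4 : A ≤ A ^ 2 := Nat.le_self_pow (by norm_num) A
    have t5 : A * n ^ 2 ≤ A ^ 2 * n ^ 2 := Nat.mul_le_mul_right _ t4
    have t6 : 1 * n ^ 2 ≤ A ^ 2 * n ^ 2 := Nat.mul_le_mul_right _ (hA1.trans t4)
    calc d * nsSize (pebPoly F (brPred m) (brSink m)) r sj
        ≤ d * (2 * ((1 + J * X + X + Y * (2 * X + 1)) + 1)) := Nat.mul_le_mul_left _ hsz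
      _ = 4 * d + 2 * ((J + 1) * (d * X)) + 2 * (Y * (2 * (d * X) + d)) := by ring
      _ ≤ 4 * n + 2 * (n * (A * (2 * n))) + 2 * ((A * n) * (2 * (A * (2 * n)) + n)) := by omega
      _ = 4 * n + 4 * (A * n ^ 2) + 8 * (A ^ 2 * n ^ 2) + 2 * (A * n ^ 2) := by ring
      _ ≤ 18 * (A ^ 2 * n ^ 2) := by omega
      _ = _ := by ring

/-- There is a family of unsatisfiable 3-CNF formulas of size `Θ(n)` such that,
over any field, for every constant `0 < δ < 1` there are constants `c₁, c₂ > 0` such that for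
all sufficiently large `n` and every `d` with `n^δ ≤ d ≤ n`: (1) there is a Nullstellensatz
refutation of degree at most `c₁ d` and size at most `c₁ n² / d`; and (2) every Nullstellensatz
refutation of degree at most `d` has size at least `c₂ n² / d`. -/
theorem nullstellensatz_smooth_tradeoff :
    ∃ φ : ℕ → CNF,
      (∀ n, (φ n).Is3CNF ∧ (φ n).Unsat) ∧
      (∃ a b : ℝ, 0 < a ∧ 0 < b ∧ ∀ n : ℕ, 1 ≤ n →
        a * n ≤ ((φ n).nvars : ℝ) ∧ ((φ n).nvars : ℝ) ≤ b * n ∧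
        a * n ≤ ((φ n).clauses.card : ℝ) ∧ ((φ n).clauses.card : ℝ) ≤ b * n) ∧
      ∀ (F : Type) [Field F], ∀ δ : ℝ, 0 < δ → δ < 1 →
        ∃ c₁ c₂ : ℝ, 0 < c₁ ∧ 0 < c₂ ∧ ∃ N : ℕ, ∀ n : ℕ, N ≤ n →
          ∀ d : ℕ, (n : ℝ) ^ δ ≤ (d : ℝ) → d ≤ n →
            -- (1) upper bound
            (∃ r s, IsNSCert ((φ n).polys F) r s ∧
              (nsDegree ((φ n).polys F) r s : ℝ) ≤ c₁ * d ∧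
              (nsSize ((φ n).polys F) r s : ℝ) ≤ c₁ * (n : ℝ) ^ 2 / d) ∧
            -- (2) lower bound
            (∀ r s, IsNSCert ((φ n).polys F) r s →
              nsDegree ((φ n).polys F) r s ≤ d →
              c₂ * (n : ℝ) ^ 2 / d ≤ (nsSize ((φ n).polys F) r s : ℝ)) := by
  refine ⟨fun n => pebCNF (2 * 2 ^ Nat.log 2 n) (brPred _) (brSink _), ?_, ?_, ?_⟩
  · intro n
    exact ⟨pebCNF_is3 (brPred_card _), pebCNF_unsat (brPred_lt _)⟩
  · refine ⟨1, 3, one_pos, by norm_num, fun n hn => ?_⟩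
    have h1 : 2 ^ Nat.log 2 n ≤ n := Nat.pow_log_le_self 2 (by omega)
    have h2 : n < 2 ^ (Nat.log 2 n + 1) := Nat.lt_pow_succ_log_self (by norm_num) _
    rw [pow_succ] at h2
    have e1 : (pebCNF (2 * 2 ^ Nat.log 2 n) (brPred _) (brSink _)).nvars =
      2 * 2 ^ Nat.log 2 n := rfl
    have e2 : (pebCNF (2 * 2 ^ Nat.log 2 n) (brPred _) (brSink _)).clauses.card =
      2 * 2 ^ Nat.log 2 n + 1 := pebCNF_card
    simp only [e1, e2]
    clear e1 e2
    generalize 2 ^ Nat.log 2 n = N at *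
    refine ⟨?_, ?_, ?_, ?_⟩
    · rw [one_mul]; exact_mod_cast (by omega : n ≤ 2 * N)
    · exact_mod_cast (by omega : 2 * N ≤ 3 * n)
    · rw [one_mul]; exact_mod_cast (by omega : n ≤ 2 * N + 1)
    · exact_mod_cast (by omega : 2 * N + 1 ≤ 3 * n)
  · intro F _ δ hδ0 hδ1
    set k := ⌈1 / δ⌉₊ with hk
    have hk1 : 1 ≤ k := Nat.ceil_pos.mpr (by positivity)
    refine ⟨18 * ((4 : ℝ) ^ k) ^ 2 + (5 + 3 * k), 1 / 64, by positivity, by norm_num, 1, ?_⟩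
    intro n hn d hnd hdn
    have hn0 : (1 : ℝ) ≤ n := by exact_mod_cast hn
    have hd1r : (1 : ℝ) ≤ d := (Real.one_le_rpow hn0 hδ0.le).trans hnd
    have hd1 : 1 ≤ d := by exact_mod_cast hd1r
    have hdpos : (0 : ℝ) < d := by linarith
    have hdk : n ≤ d ^ k := by
      have h1 : (n : ℝ) ≤ (d : ℝ) ^ (1 / δ) := by
        calc (n : ℝ) = ((n : ℝ) ^ δ) ^ (1 / δ) := by
              rw [← Real.rpow_mul (by linarith), mul_one_div_cancel hδ0.ne', Real.rpow_one]
          _ ≤ (d : ℝ) ^ (1 / δ) := Real.rpow_le_rpow (by positivity) hnd (by positivity)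
      have h2 : (d : ℝ) ^ (1 / δ) ≤ (d : ℝ) ^ (k : ℝ) :=
        Real.rpow_le_rpow_of_exponent_le hd1r (Nat.le_ceil _)
      rw [Real.rpow_natCast] at h2
      exact_mod_cast h1.trans h2
    have hm1 : 2 ^ Nat.log 2 n ≤ n := Nat.pow_log_le_self 2 (by omega)
    have hm2 : n < 2 ^ (Nat.log 2 n + 1) := Nat.lt_pow_succ_log_self (by norm_num) _
    constructor
    · obtain ⟨r, sj, hc, hdg, hsz⟩ := br_ns_upper F (Nat.log 2 n) n d k hk1 hd1 hdn hm1 hdk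
      refine ⟨r, sj, hc, ?_, ?_⟩
      · have h1 : (nsDegree (pebPoly F (brPred (Nat.log 2 n)) (brSink _)) r sj : ℝ) ≤
            (5 + 3 * k) * d := by exact_mod_cast hdg
        refine le_trans h1 ?_
        have : (0 : ℝ) ≤ 18 * ((4 : ℝ) ^ k) ^ 2 := by positivity
        nlinarith
      · have h1 : (d : ℝ) * (nsSize (pebPoly F (brPred (Nat.log 2 n)) (brSink _)) r sj : ℝ) ≤
            18 * ((4 : ℝ) ^ k) ^ 2 * (n : ℝ) ^ 2 := by exact_mod_cast hsz
        rw [le_div_iff₀ hdpos]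
        refine le_trans (le_of_eq (mul_comm _ _)) (h1.trans ?_)
        have : (0 : ℝ) ≤ (5 + 3 * k) * (n : ℝ) ^ 2 := by positivity
        nlinarith
    · intro r sj hc hdg
      have h1 := br_lower F (Nat.log 2 n) d hd1 r sj hc hdg
      have h2 : n * n ≤ 64 * (d * nsSize (pebPoly F (brPred (Nat.log 2 n)) (brSink _)) r sj) := by
        rw [pow_succ] at hm2
        generalize nsSize (pebPoly F (brPred (Nat.log 2 n)) (brSink _)) r sj = S at h1 ⊢
        generalize 2 ^ Nat.log 2 n = N at h1 hm2
        have h4 : n * n ≤ (N * 2) * (N * 2) := Nat.mul_le_mul hm2.le hm2.le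
        have h5 : (N * 2) * (N * 2) = 4 * (N * N) := by ring
        omega
      have h3 : (n : ℝ) * n ≤
          64 * (d * (nsSize (pebPoly F (brPred (Nat.log 2 n)) (brSink _)) r sj : ℝ)) := by
        exact_mod_cast h2
      rw [div_le_iff₀ hdpos]
      change _ ≤ (nsSize (pebPoly F (brPred (Nat.log 2 n)) (brSink _)) r sj : ℝ) * d
      nlinarith
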